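/- Let 2 ≤ k ≤ n be integers and let λ ∈ Γ_k. Then (n−k+1)·σ_{k−1}(λ)² − (n−k+2)·σ_k(λ)·σ_{k−2}(λ) ≥ ((n−k+1)/k)·σ_{k−1}(λ)². -/

import Mathlib

/-- The `m`-th elementary symmetric function of `λ = (λ_1, …, λ_n) ∈ ℝⁿ`. -/
def esymm (n m : ℕ) (lam : Fin n → ℝ) : ℝ :=
  ∑ s ∈ (Finset.univ : Finset (Fin n)).powersetCard m, ∏ i ∈ s, lam i

/-- The Gårding cone `Γ_k = {λ ∈ ℝⁿ : σ_j(λ) > 0 for all 1 ≤ j ≤ k}`. -/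
def GardingCone (n m : ℕ) : Set (Fin n → ℝ) :=
  {lam | ∀ j : ℕ, 1 ≤ j → j ≤ m → 0 < esymm n j lam}

open Polynomial in
/-- Laguerre's inequality for a product of real monic linear factors. -/
theorem laguerre_inequality_prod_X_sub_C (s : Multiset ℝ) (x : ℝ) :
    (s.card : ℝ) * ((s.map fun r => X - C r).prod.eval x *
        (derivative (derivative (s.map fun r => X - C r).prod)).eval x) ≤
      ((s.card : ℝ) - 1) * (derivative (s.map fun r => X - C r).prod).eval x ^ 2 := by
  induction s using Multiset.induction_on with
  | empty => simp
  | cons r s ih =>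
    rcases Nat.eq_zero_or_pos s.card with h0 | hpos
    · rw [Multiset.card_eq_zero] at h0
      simp [h0]
    · have hm : (0 : ℝ) < s.card := by exact_mod_cast hpos
      simp only [Multiset.map_cons, Multiset.prod_cons, Multiset.card_cons, derivative_mul,
        derivative_add, derivative_sub, derivative_X, derivative_C, derivative_one,
        derivative_zero, eval_add, eval_mul, eval_sub, eval_X, eval_C, eval_one, eval_zero,
        Nat.cast_add, Nat.cast_one]
      generalize (s.map fun r => X - C r).prod = g at ih ⊢
      generalize eval x (derivative (derivative g)) = g'' at ih ⊢
      generalize eval x (derivative g) = g' at ih ⊢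
      generalize eval x g = g at ih ⊢
      generalize (s.card : ℝ) = m at *
      refine le_of_mul_le_mul_left ?_ hm
      have h1 : 0 ≤ (x - r) ^ 2 * (m + 1) * ((m - 1) * g' ^ 2 - m * (g * g'')) :=
        mul_nonneg (by positivity) (by linarith)
      nlinarith [sq_nonneg (m * g - (x - r) * g')]

open Polynomial in
/-- Laguerre's inequality for real polynomials that split. -/
theorem Polynomial.Splits.laguerre_inequality {p : ℝ[X]} (hp : p.Splits) (x : ℝ) :
    (p.natDegree : ℝ) * (p.eval x * (derivative (derivative p)).eval x) ≤
      ((p.natDegree : ℝ) - 1) * (derivative p).eval x ^ 2 := by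
  have h := laguerre_inequality_prod_X_sub_C p.roots x
  rw [← hp.natDegree_eq_card_roots] at h
  have hprod := hp.eq_prod_roots
  generalize (p.roots.map fun r => X - C r).prod = q at h hprod
  have h0 : p.eval x = p.leadingCoeff * q.eval x := by
    conv_lhs => rw [hprod]
    simp
  have h1 : (derivative p).eval x = p.leadingCoeff * (derivative q).eval x := by
    conv_lhs => rw [hprod]
    simp
  have h2 : (derivative (derivative p)).eval x =
      p.leadingCoeff * (derivative (derivative q)).eval x := by
    conv_lhs => rw [hprod]
    simp
  rw [h0, h1, h2]
  nlinarith [mul_le_mul_of_nonneg_left h (sq_nonneg p.leadingCoeff)]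

open Polynomial in
/-- The derivative of a real polynomial that splits also splits, by Rolle's theorem. -/
theorem Polynomial.Splits.derivative_real {p : ℝ[X]} (hp : p.Splits) :
    (derivative p).Splits := by
  rw [splits_iff_card_roots]
  have h1 := card_roots_le_derivative p
  have h2 := card_roots' (derivative p)
  have h3 := natDegree_derivative_le p
  have h4 := hp.natDegree_eq_card_roots
  rcases Nat.eq_zero_or_pos p.natDegree with h | h <;> omega

open Polynomial in
theorem Polynomial.Splits.iterate_derivative_real {p : ℝ[X]} (hp : p.Splits) (m : ℕ) :
    (derivative^[m] p).Splits := by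
  induction m with
  | zero => exact hp
  | succ m ih =>
    rw [Function.iterate_succ_apply']
    exact ih.derivative_real

open Polynomial in
theorem natDegree_iterate_derivative_eq (p : ℝ[X]) (m : ℕ) :
    (derivative^[m] p).natDegree = p.natDegree - m := by
  induction m with
  | zero => rfl
  | succ m ih => rw [Function.iterate_succ_apply', natDegree_derivative, ih, Nat.sub_sub]

open Polynomial in
/-- Newton's inequality for the coefficients of a real polynomial that splits. -/
theorem Polynomial.Splits.newton_inequality {p : ℝ[X]} (hp : p.Splits) {m d : ℕ}
    (hd : p.natDegree = m + d) :
    (d : ℝ) * (m + 2) * (p.coeff m * p.coeff (m + 2)) ≤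
      ((d : ℝ) - 1) * (m + 1) * p.coeff (m + 1) ^ 2 := by
  have hdeg : (derivative^[m] p).natDegree = d := by
    rw [natDegree_iterate_derivative_eq, hd, Nat.add_sub_cancel_left]
  have h := (hp.iterate_derivative_real m).laguerre_inequality 0
  have heval (j : ℕ) : (derivative^[j] p).eval 0 = (j.factorial : ℝ) * p.coeff j := by
    rw [← coeff_zero_eq_eval_zero, coeff_iterate_derivative]
    simp [Nat.descFactorial_self]
  rw [hdeg, ← Function.iterate_succ_apply' derivative, ← Function.iterate_succ_apply' derivative,
    heval, heval, heval] at h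
  simp only [Nat.factorial_succ, Nat.succ_eq_add_one, Nat.cast_mul, Nat.cast_add,
    Nat.cast_one] at h
  have hf : (0 : ℝ) < (m.factorial : ℝ) ^ 2 * (m + 1) := by positivity
  refine le_of_mul_le_mul_left ?_ hf
  linarith

open Polynomial in
theorem coeff_prod_X_add_C_eq_esymm {n j : ℕ} (hj : j ≤ n) (lam : Fin n → ℝ) :
    (∏ i, (X + C (lam i))).coeff (n - j) = esymm n j lam := by
  rw [Finset.prod_X_add_C_coeff _ _ (by simp)]
  simp [esymm, Nat.sub_sub_self hj]

/-- For `2 ≤ k ≤ n` and `λ ∈ Γ_k`: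
`(n-k+1)·σ_{k-1}(λ)² - (n-k+2)·σ_k(λ)·σ_{k-2}(λ) ≥ ((n-k+1)/k)·σ_{k-1}(λ)²`. -/
theorem key_quadratic_inequality (n k : ℕ) (hk : 2 ≤ k) (hkn : k ≤ n)
    (lam : Fin n → ℝ) (hlam : lam ∈ GardingCone n k) :
    ((n : ℝ) - (k : ℝ) + 1) / (k : ℝ) * (esymm n (k - 1) lam) ^ 2 ≤
      ((n : ℝ) - (k : ℝ) + 1) * (esymm n (k - 1) lam) ^ 2 -
        ((n : ℝ) - (k : ℝ) + 2) * esymm n k lam * esymm n (k - 2) lam := by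
  have hsplit : (∏ i, (Polynomial.X + Polynomial.C (lam i))).Splits :=
    Polynomial.Splits.prod fun i _ => Polynomial.Splits.X_add_C (lam i)
  have hdeg : (∏ i, (Polynomial.X + Polynomial.C (lam i))).natDegree = (n - k) + k := by
    rw [Polynomial.natDegree_prod_of_monic _ _ fun i _ => Polynomial.monic_X_add_C (lam i)]
    simp [Nat.sub_add_cancel hkn]
  have h := hsplit.newton_inequality hdeg
  rw [show n - k + 2 = n - (k - 2) by omega, show n - k + 1 = n - (k - 1) by omega,
    coeff_prod_X_add_C_eq_esymm hkn, coeff_prod_X_add_C_eq_esymm (by omega),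
    coeff_prod_X_add_C_eq_esymm (by omega), Nat.cast_sub hkn] at h
  have hk0 : (0 : ℝ) < k := by exact_mod_cast (by omega : 0 < k)
  rw [div_mul_eq_mul_div, div_le_iff₀ hk0]
  linarith
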